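/- arXiv:2012.05109 — 13 statements merged into one kernel-verified Lean document; each statement's English description precedes it below -/
import Mathlib

section
/- Fix real numbers λ > 0, μ > 0, w > 0, γ > 0 and p ∈ (0,1]. Then the discriminant (w(λ + μp + λγ) + λμ)² − 4λ(λ + μp)γw² is nonnegative, and a real number x satisfies 0 ≤ x < 1/γ together with the policy-(W) equilibrium quadratic equation wγ(λ+μp)·x² − (w(λ + μp + λγ) + λμ)·x + λw = 0 if and only if x = [w(λ + μp + λγ) + λμ − √((w(λ + μp + λγ) + λμ)² − 4λ(λ + μp)γw²)] / (2wγ(λ + μp)). In particular the equilibrium fraction of devices in service under policy (W) exists and is unique in [0, 1/γ). -/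
/-- If `q x = a * x ^ 2 - b * x + c` is negative at `t`, then its discriminant exceeds the square
of `2 * a * t - b`, so `t` lies strictly between the two roots. -/
lemma abs_lt_sqrt_discrim_of_quadratic_neg {a b c t : ℝ} (ha : 0 < a)
    (hneg : a * t ^ 2 - b * t + c < 0) : |2 * a * t - b| < √(b ^ 2 - 4 * a * c) := by
  apply Real.lt_sqrt_of_sq_lt
  rw [sq_abs]
  nlinarith [mul_neg_of_pos_of_neg ha hneg]

/-- A quadratic with `0 ≤ q 0` and `q t < 0` has exactly one root in `[0, t)`: the smaller one. -/
lemma root_mem_Ico_iff_of_quadratic_neg {a b c t : ℝ} (ha : 0 < a) (hc : 0 ≤ c) (ht : 0 < t)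
    (hneg : a * t ^ 2 - b * t + c < 0) (x : ℝ) :
    (0 ≤ x ∧ x < t ∧ a * x ^ 2 - b * x + c = 0) ↔ x = (b - √(b ^ 2 - 4 * a * c)) / (2 * a) := by
  obtain ⟨hlow, hupp⟩ := abs_lt.mp (abs_lt_sqrt_discrim_of_quadratic_neg ha hneg)
  have hb : 0 < b := by
    have : 0 < b * t := by nlinarith [mul_pos ha (pow_pos ht 2)]
    exact pos_of_mul_pos_left this ht.le
  have hD : 0 ≤ b ^ 2 - 4 * a * c :=
    (Real.sqrt_pos.mp ((abs_nonneg _).trans_lt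
      (abs_lt_sqrt_discrim_of_quadratic_neg ha hneg))).le
  have hsq := Real.sq_sqrt hD
  have hle : √(b ^ 2 - 4 * a * c) ≤ b :=
    Real.sqrt_le_iff.mpr ⟨hb.le, by nlinarith [mul_nonneg ha.le hc]⟩
  rw [eq_div_iff (by positivity)]
  generalize √(b ^ 2 - 4 * a * c) = s at *
  constructor
  · rintro ⟨-, hxt, hx⟩
    have hfac : (x * (2 * a) - (b - s)) * (x * (2 * a) - (b + s)) = 0 := by
      linear_combination 4 * a * hx - hsq
    rcases mul_eq_zero.mp hfac with h | h
    · linarith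
    · nlinarith [mul_lt_mul_of_pos_left hxt ha]
  · intro hx
    refine ⟨?_, ?_, ?_⟩
    · by_contra! h
      nlinarith [mul_pos_of_neg_of_neg h (neg_lt_zero.mpr ha)]
    · refine lt_of_mul_lt_mul_right (a := 2 * a) ?_ (by positivity)
      linarith
    · have hz : 4 * a * (a * x ^ 2 - b * x + c) = 0 := by
        linear_combination (x * (2 * a) - b - s) * hx + hsq
      exact (mul_eq_zero.mp hz).resolve_left (by positivity)

theorem stmt5 (lam mu w γ p : ℝ) (hlam : 0 < lam) (hmu : 0 < mu) (hw : 0 < w)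
    (hγ : 0 < γ) (hp0 : 0 < p) (hp1 : p ≤ 1) :
    0 ≤ (w * (lam + mu * p + lam * γ) + lam * mu)^2 - 4 * lam * (lam + mu * p) * γ * w^2 ∧
    ∀ x : ℝ,
      (0 ≤ x ∧ x < 1/γ ∧
        w * γ * (lam + mu * p) * x^2 - (w * (lam + mu * p + lam * γ) + lam * mu) * x + lam * w = 0)
      ↔ x = (w * (lam + mu * p + lam * γ) + lam * mu
              - Real.sqrt ((w * (lam + mu * p + lam * γ) + lam * mu)^2
                  - 4 * lam * (lam + mu * p) * γ * w^2))
            / (2 * w * γ * (lam + mu * p)) := by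
  have ha : 0 < w * γ * (lam + mu * p) := by positivity
  have hneg : w * γ * (lam + mu * p) * (1 / γ) ^ 2
      - (w * (lam + mu * p + lam * γ) + lam * mu) * (1 / γ) + lam * w < 0 := by
    have heq : w * γ * (lam + mu * p) * (1 / γ) ^ 2
        - (w * (lam + mu * p + lam * γ) + lam * mu) * (1 / γ) + lam * w = -(lam * mu / γ) := by
      field_simp
      ring
    rw [heq, neg_lt_zero]
    positivity
  have hdisc : 4 * lam * (lam + mu * p) * γ * w ^ 2
      = 4 * (w * γ * (lam + mu * p)) * (lam * w) := by ring
  have hden : 2 * w * γ * (lam + mu * p) = 2 * (w * γ * (lam + mu * p)) := by ring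
  rw [hdisc, hden]
  exact ⟨(Real.sqrt_pos.mp ((abs_nonneg _).trans_lt
      (abs_lt_sqrt_discrim_of_quadratic_neg ha hneg))).le,
    root_mem_Ico_iff_of_quadratic_neg ha (by positivity) (by positivity) hneg⟩
end

section
/- Fix real numbers λ > 0, μ > 0, w > 0, γ > 0 and p ∈ (0,1]. Then the discriminant (w(λ + μp + λγ) + λμp)² − 4λ(λ + μp)γw² is nonnegative, and a real number x satisfies 0 ≤ x < 1/γ together with the policy-(S) equilibrium quadratic equation wγ(λ+μp)·x² − (w(λ + μp + λγ) + λμp)·x + λw = 0 if and only if x = [w(λ + μp + λγ) + λμp − √((w(λ + μp + λγ) + λμp)² − 4λ(λ + μp)γw²)] / (2wγ(λ + μp)). In particular the equilibrium fraction of devices in service under policy (S) exists and is unique in [0, 1/γ). -/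
/-- If a convex quadratic is negative at `t`, its discriminant is positive. -/
theorem discrim_pos_of_quadratic_neg {a b c t : ℝ} (ha : 0 < a)
    (ht : a * t ^ 2 - b * t + c < 0) : 0 < b ^ 2 - 4 * a * c := by
  nlinarith [sq_nonneg (2 * a * t - b), mul_neg_of_pos_of_neg ha ht]

/-- If a convex quadratic with alternating signs is negative at `t`, then its smaller root is its
only root in `[0, t)`. -/
theorem quadratic_root_mem_Ico_iff {a b c t : ℝ} (ha : 0 < a) (hb : 0 ≤ b) (hc : 0 ≤ c)
    (ht : a * t ^ 2 - b * t + c < 0) (x : ℝ) :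
    (0 ≤ x ∧ x < t ∧ a * x ^ 2 - b * x + c = 0) ↔
      x = (b - Real.sqrt (b ^ 2 - 4 * a * c)) / (2 * a) := by
  have hd := discrim_pos_of_quadratic_neg ha ht
  have hsq := Real.sq_sqrt hd.le
  have hle : Real.sqrt (b ^ 2 - 4 * a * c) ≤ b :=
    (Real.sqrt_le_left hb).mpr (by nlinarith [mul_nonneg ha.le hc])
  have habs : |2 * a * t - b| < Real.sqrt (b ^ 2 - 4 * a * c) :=
    Real.lt_sqrt_of_sq_lt (by rw [sq_abs]; nlinarith [mul_neg_of_pos_of_neg ha ht])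
  obtain ⟨hlo, hhi⟩ := abs_lt.mp habs
  rw [eq_div_iff (by positivity)]
  constructor
  · rintro ⟨-, hxt, hx⟩
    have h : (2 * a * x - b) ^ 2 = Real.sqrt (b ^ 2 - 4 * a * c) ^ 2 := by
      rw [hsq]; linear_combination 4 * a * hx
    rcases sq_eq_sq_iff_eq_or_eq_neg.mp h with h | h
    · nlinarith [mul_lt_mul_of_pos_left hxt ha]
    · linarith
  · intro h
    refine ⟨?_, ?_, ?_⟩
    · exact nonneg_of_mul_nonneg_left (by linarith : 0 ≤ x * (2 * a)) (by positivity)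
    · exact lt_of_mul_lt_mul_right (by linarith : x * (2 * a) < t * (2 * a)) (by positivity)
    · have hs : Real.sqrt (b ^ 2 - 4 * a * c) = b - x * (2 * a) := by linarith
      rw [hs] at hsq
      exact (mul_eq_zero.mp (by linear_combination hsq :
        4 * a * (a * x ^ 2 - b * x + c) = 0)).resolve_left (by positivity)

theorem stmt7 (lam mu w γ p : ℝ) (hlam : 0 < lam) (hmu : 0 < mu) (hw : 0 < w)
    (hγ : 0 < γ) (hp0 : 0 < p) (hp1 : p ≤ 1) :
    0 ≤ (w * (lam + mu * p + lam * γ) + lam * mu * p)^2 - 4 * lam * (lam + mu * p) * γ * w^2 ∧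
    ∀ x : ℝ,
      (0 ≤ x ∧ x < 1/γ ∧
        w * γ * (lam + mu * p) * x^2
          - (w * (lam + mu * p + lam * γ) + lam * mu * p) * x + lam * w = 0)
      ↔ x = (w * (lam + mu * p + lam * γ) + lam * mu * p
              - Real.sqrt ((w * (lam + mu * p + lam * γ) + lam * mu * p)^2
                  - 4 * lam * (lam + mu * p) * γ * w^2))
            / (2 * w * γ * (lam + mu * p)) := by
  have ha : 0 < w * γ * (lam + mu * p) := by positivity
  have hb : 0 ≤ w * (lam + mu * p + lam * γ) + lam * mu * p := by positivity
  have hc : 0 ≤ lam * w := by positivity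
  have ht : w * γ * (lam + mu * p) * (1 / γ) ^ 2
      - (w * (lam + mu * p + lam * γ) + lam * mu * p) * (1 / γ) + lam * w < 0 := by
    have h : w * γ * (lam + mu * p) * (1 / γ) ^ 2
        - (w * (lam + mu * p + lam * γ) + lam * mu * p) * (1 / γ) + lam * w
        = -(lam * mu * p / γ) := by
      field_simp
      ring
    rw [h, neg_lt_zero]
    positivity
  have hdisc : 4 * lam * (lam + mu * p) * γ * w ^ 2
      = 4 * (w * γ * (lam + mu * p)) * (lam * w) := by ring
  have hden : 2 * w * γ * (lam + mu * p) = 2 * (w * γ * (lam + mu * p)) := by ring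
  rw [hdisc, hden]
  exact ⟨(discrim_pos_of_quadratic_neg ha ht).le, quadratic_root_mem_Ico_iff ha hb hc ht⟩
end

section
/- Fix real numbers μ > 0, w > 0, γ > 0 and p ∈ (0,1]. Let 0 < λ₁ < λ₂, and let x₁, x₂ ∈ [0, 1/γ) satisfy the policy-(S) equilibrium quadratic equation wγ(λᵢ+μp)·xᵢ² − (w(λᵢ + μp + λᵢγ) + λᵢμp)·xᵢ + λᵢw = 0 for i = 1, 2. Then x₁ < x₂; that is, the equilibrium fraction x_S* of devices in service under policy (S) is strictly increasing in the arrival rate λ. -/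
/-- The equilibrium equation of policy (S) with `m = mu * p`, solved for the inverse arrival rate. -/
theorem equilibrium_inv_rate {m w γ lam x : ℝ} (hw : 0 < w) (hγ : 0 < γ) (hlam : 0 < lam)
    (hx0 : 0 ≤ x) (hx1 : x < 1 / γ)
    (hq : w * γ * (lam + m) * x ^ 2 - (w * (lam + m + lam * γ) + lam * m) * x + lam * w = 0) :
    0 < x ∧ 0 < 1 - γ * x ∧ w * m / lam = w * (1 / x - 1) - m / (1 - γ * x) := by
  have hx : 0 < x := by
    refine hx0.lt_of_ne ?_
    rintro rfl
    have := mul_pos hlam hw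
    linarith
  have hu : 0 < 1 - γ * x := by
    rw [lt_div_iff₀ hγ] at hx1
    linarith
  refine ⟨hx, hu, ?_⟩
  have hu' := hu.ne'
  have key : w * m * (x * (1 - γ * x)) = (w * (1 - x) * (1 - γ * x) - m * x) * lam := by
    linear_combination -hq
  have hrhs : w * (1 / x - 1) - m / (1 - γ * x)
      = (w * (1 - x) * (1 - γ * x) - m * x) / (x * (1 - γ * x)) := by
    rw [eq_div_iff (mul_pos hx hu).ne', sub_mul, div_mul_eq_mul_div, mul_left_comm m,
      mul_div_assoc, mul_div_assoc, div_self hu', one_div]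
    linear_combination w * (1 - γ * x) * mul_inv_cancel₀ hx.ne'
  rw [hrhs, div_eq_div_iff hlam.ne' (mul_pos hx hu).ne', key]

theorem stmt8 (mu w γ p : ℝ) (hmu : 0 < mu) (hw : 0 < w) (hγ : 0 < γ)
    (hp0 : 0 < p) (hp1 : p ≤ 1)
    (lam₁ lam₂ x₁ x₂ : ℝ) (hlam₁ : 0 < lam₁) (hlam : lam₁ < lam₂)
    (hx₁0 : 0 ≤ x₁) (hx₁1 : x₁ < 1/γ)
    (hq₁ : w * γ * (lam₁ + mu * p) * x₁^2
        - (w * (lam₁ + mu * p + lam₁ * γ) + lam₁ * mu * p) * x₁ + lam₁ * w = 0)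
    (hx₂0 : 0 ≤ x₂) (hx₂1 : x₂ < 1/γ)
    (hq₂ : w * γ * (lam₂ + mu * p) * x₂^2
        - (w * (lam₂ + mu * p + lam₂ * γ) + lam₂ * mu * p) * x₂ + lam₂ * w = 0) :
    x₁ < x₂ := by
  obtain ⟨_, hu₁, h₁⟩ := equilibrium_inv_rate (m := mu * p) hw hγ hlam₁ hx₁0 hx₁1
    (by linear_combination hq₁)
  obtain ⟨hx₂, _, h₂⟩ := equilibrium_inv_rate (m := mu * p) hw hγ (hlam₁.trans hlam) hx₂0 hx₂1
    (by linear_combination hq₂)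
  by_contra! hle
  have hm : 0 < mu * p := mul_pos hmu hp0
  have hrate : w * (mu * p) / lam₂ < w * (mu * p) / lam₁ :=
    div_lt_div_of_pos_left (mul_pos hw hm) hlam₁ hlam
  have hinv : w * (1 / x₁ - 1) ≤ w * (1 / x₂ - 1) := by gcongr
  have hidle : mu * p / (1 - γ * x₂) ≤ mu * p / (1 - γ * x₁) := by gcongr
  linarith
end

section
/- Fix real numbers λ > 0, w > 0, γ > 0 and p ∈ (0,1]. Let 0 < μ₁ < μ₂, and let x₁, x₂ ∈ [0, 1/γ) satisfy the policy-(S) equilibrium quadratic equation wγ(λ+μᵢp)·xᵢ² − (w(λ + μᵢp + λγ) + λμᵢp)·xᵢ + λw = 0 for i = 1, 2. Then x₁ > x₂; that is, the equilibrium fraction x_S* of devices in service under policy (S) is strictly decreasing in the service rate μ. -/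
theorem stmt9 (lam w γ p : ℝ) (hlam : 0 < lam) (hw : 0 < w) (hγ : 0 < γ)
    (hp0 : 0 < p) (hp1 : p ≤ 1)
    (mu₁ mu₂ x₁ x₂ : ℝ) (hmu₁ : 0 < mu₁) (hmu : mu₁ < mu₂)
    (hx₁0 : 0 ≤ x₁) (hx₁1 : x₁ < 1/γ)
    (hq₁ : w * γ * (lam + mu₁ * p) * x₁^2
        - (w * (lam + mu₁ * p + lam * γ) + lam * mu₁ * p) * x₁ + lam * w = 0)
    (hx₂0 : 0 ≤ x₂) (hx₂1 : x₂ < 1/γ)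
    (hq₂ : w * γ * (lam + mu₂ * p) * x₂^2
        - (w * (lam + mu₂ * p + lam * γ) + lam * mu₂ * p) * x₂ + lam * w = 0) :
    x₂ < x₁ := by
  have hu₁ : 0 < 1 - γ * x₁ := by
    rw [lt_div_iff₀ hγ] at hx₁1
    linarith
  have hu₂ : 0 < 1 - γ * x₂ := by
    rw [lt_div_iff₀ hγ] at hx₂1
    linarith
  have hx₂ : 0 < x₂ := by
    refine hx₂0.lt_of_ne ?_
    rintro rfl
    have := mul_pos hlam hw
    linarith
  have balance₁ : lam * w * (1 - x₁) * (1 - γ * x₁)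
      = mu₁ * p * x₁ * (w * (1 - γ * x₁) + lam) := by
    linear_combination hq₁
  have balance₂ : lam * w * (1 - x₂) * (1 - γ * x₂)
      = mu₂ * p * x₂ * (w * (1 - γ * x₂) + lam) := by
    linear_combination hq₂
  by_contra! hle
  have hu : 1 - γ * x₂ ≤ 1 - γ * x₁ := by gcongr
  set u₁ := 1 - γ * x₁
  set u₂ := 1 - γ * x₂
  have hleft : lam * w * (1 - x₂) * (u₁ * u₂) ≤ lam * w * (1 - x₁) * (u₁ * u₂) := by
    gcongr
  have hright : mu₁ * p * x₁ * (w * u₁ * u₂ + lam * u₂)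
      < mu₂ * p * x₂ * (w * u₁ * u₂ + lam * u₁) := by
    calc mu₁ * p * x₁ * (w * u₁ * u₂ + lam * u₂)
        ≤ mu₁ * p * x₂ * (w * u₁ * u₂ + lam * u₁) := by gcongr
      _ < mu₂ * p * x₂ * (w * u₁ * u₂ + lam * u₁) := by gcongr
  have h₁ : lam * w * (1 - x₁) * (u₁ * u₂)
      = mu₁ * p * x₁ * (w * u₁ * u₂ + lam * u₂) := by
    linear_combination u₂ * balance₁
  have h₂ : lam * w * (1 - x₂) * (u₁ * u₂)
      = mu₂ * p * x₂ * (w * u₁ * u₂ + lam * u₁) := by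
    linear_combination u₁ * balance₂
  linarith
end

section
/- Fix real numbers λ > 0, μ > 0, γ > 0 and p ∈ (0,1]. Let 0 < w₁ < w₂, and let x₁, x₂ ∈ [0, 1/γ) satisfy the policy-(S) equilibrium quadratic equation wᵢγ(λ+μp)·xᵢ² − (wᵢ(λ + μp + λγ) + λμp)·xᵢ + λwᵢ = 0 for i = 1, 2. Then x₁ < x₂; that is, the equilibrium fraction x_S* of devices in service under policy (S) is strictly increasing in the waiting rate w. -/
theorem stmt10 (lam mu γ p : ℝ) (hlam : 0 < lam) (hmu : 0 < mu) (hγ : 0 < γ)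
    (hp0 : 0 < p) (hp1 : p ≤ 1)
    (w₁ w₂ x₁ x₂ : ℝ) (hw₁ : 0 < w₁) (hw : w₁ < w₂)
    (hx₁0 : 0 ≤ x₁) (hx₁1 : x₁ < 1/γ)
    (hq₁ : w₁ * γ * (lam + mu * p) * x₁^2
        - (w₁ * (lam + mu * p + lam * γ) + lam * mu * p) * x₁ + lam * w₁ = 0)
    (hx₂0 : 0 ≤ x₂) (hx₂1 : x₂ < 1/γ)
    (hq₂ : w₂ * γ * (lam + mu * p) * x₂^2
        - (w₂ * (lam + mu * p + lam * γ) + lam * mu * p) * x₂ + lam * w₂ = 0) :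
    x₁ < x₂ := by
  by_contra! hle
  have ha : 0 < lam + mu * p := by positivity
  have hc : 0 < lam * mu * p := by positivity
  have e₁ : w₁ * ((1 - γ * x₁) * (lam - (lam + mu * p) * x₁)) = lam * mu * p * x₁ := by
    linear_combination hq₁
  have e₂ : w₂ * ((1 - γ * x₂) * (lam - (lam + mu * p) * x₂)) = lam * mu * p * x₂ := by
    linear_combination hq₂
  have hx₁ : 0 < x₁ := by
    refine lt_of_le_of_ne hx₁0 fun h => ?_
    rw [← h] at e₁
    have : 0 < w₁ * lam := by positivity
    linarith
  have hu₁ : 0 < 1 - γ * x₁ := by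
    rw [lt_div_iff₀ hγ] at hx₁1
    linarith
  have hprod : 0 < (1 - γ * x₁) * (lam - (lam + mu * p) * x₁) := by
    refine pos_of_mul_pos_right (a := w₁) ?_ hw₁.le
    rw [e₁]
    positivity
  have hv₁ : 0 < lam - (lam + mu * p) * x₁ := pos_of_mul_pos_right hprod hu₁.le
  have hmono : (1 - γ * x₁) * (lam - (lam + mu * p) * x₁)
      ≤ (1 - γ * x₂) * (lam - (lam + mu * p) * x₂) := by
    have hu : 1 - γ * x₁ ≤ 1 - γ * x₂ := by gcongr
    have hv : lam - (lam + mu * p) * x₁ ≤ lam - (lam + mu * p) * x₂ := by gcongr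
    exact mul_le_mul hu hv hv₁.le (hu₁.le.trans hu)
  have hlt := mul_lt_mul_of_pos_right hw hprod
  have hle' := mul_le_mul_of_nonneg_left hmono (hw₁.trans hw).le
  have hcx := mul_le_mul_of_nonneg_left hle hc.le
  linarith
end

section
/- Fix real numbers λ > 0, μ > 0, w > 0 and p ∈ (0,1]. Let 0 < γ₁ < γ₂, and let x₁, x₂ satisfy 0 ≤ xᵢ < 1/γᵢ and the policy-(S) equilibrium quadratic equation wγᵢ(λ+μp)·xᵢ² − (w(λ + μp + λγᵢ) + λμp)·xᵢ + λw = 0 for i = 1, 2. Then x₁ > x₂; that is, the equilibrium fraction x_S* of devices in service under policy (S) is strictly decreasing in the device-to-channel ratio γ. -/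
theorem stmt11 (lam mu w p : ℝ) (hlam : 0 < lam) (hmu : 0 < mu) (hw : 0 < w)
    (hp0 : 0 < p) (hp1 : p ≤ 1)
    (γ₁ γ₂ x₁ x₂ : ℝ) (hγ₁ : 0 < γ₁) (hγ : γ₁ < γ₂)
    (hx₁0 : 0 ≤ x₁) (hx₁1 : x₁ < 1/γ₁)
    (hq₁ : w * γ₁ * (lam + mu * p) * x₁^2
        - (w * (lam + mu * p + lam * γ₁) + lam * mu * p) * x₁ + lam * w = 0)
    (hx₂0 : 0 ≤ x₂) (hx₂1 : x₂ < 1/γ₂)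
    (hq₂ : w * γ₂ * (lam + mu * p) * x₂^2
        - (w * (lam + mu * p + lam * γ₂) + lam * mu * p) * x₂ + lam * w = 0) :
    x₂ < x₁ := by
  have hc : 0 < lam * mu * p := by positivity
  have hγ₂ : 0 < γ₂ := hγ₁.trans hγ
  have e₁ : w * ((1 - γ₁ * x₁) * (lam - (lam + mu * p) * x₁)) = lam * mu * p * x₁ := by
    linear_combination hq₁
  have e₂ : w * ((1 - γ₂ * x₂) * (lam - (lam + mu * p) * x₂)) = lam * mu * p * x₂ := by
    linear_combination hq₂
  have hx₂ : 0 < x₂ := by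
    refine hx₂0.lt_of_ne ?_
    rintro rfl
    have : 0 < lam * w := by positivity
    linarith
  have h₂ : 0 < 1 - γ₂ * x₂ := by
    rw [lt_div_iff₀ hγ₂] at hx₂1
    linarith
  have hpos : 0 < lam - (lam + mu * p) * x₂ := by
    have h : 0 < w * ((1 - γ₂ * x₂) * (lam - (lam + mu * p) * x₂)) := by
      rw [e₂]
      positivity
    exact (pos_iff_pos_of_mul_pos ((pos_iff_pos_of_mul_pos h).1 hw)).1 h₂
  by_contra! hle
  have hidle : 1 - γ₂ * x₂ < 1 - γ₁ * x₁ := by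
    have : γ₁ * x₁ ≤ γ₁ * x₂ := by gcongr
    have : γ₁ * x₂ < γ₂ * x₂ := by gcongr
    linarith
  have hfac : lam - (lam + mu * p) * x₂ ≤ lam - (lam + mu * p) * x₁ := by gcongr
  have hprod : lam * mu * p * x₂ < lam * mu * p * x₁ := by
    rw [← e₁, ← e₂]
    exact mul_lt_mul_of_pos_left (mul_lt_mul hidle hfac hpos (h₂.trans hidle).le) hw
  exact hle.not_gt (lt_of_mul_lt_mul_left hprod hc.le)
end

section
/- Fix real numbers λ > 0, μ > 0, w > 0 and γ > 0. Let 0 < p₁ < p₂ ≤ 1, and let x₁, x₂ ∈ [0, 1/γ) satisfy the policy-(S) equilibrium quadratic equation wγ(λ+μpᵢ)·xᵢ² − (w(λ + μpᵢ + λγ) + λμpᵢ)·xᵢ + λw = 0 for i = 1, 2. Then x₁ > x₂; that is, the equilibrium fraction x_S* of devices in service under policy (S) is strictly decreasing in the successful transmission probability p. -/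
/-- A root of the equilibrium quadratic in `[0, 1/γ)` lies in `(0, 1)`, and solves the balance form
of the equation. -/
lemma equilibrium_balance {lam mu w γ p x : ℝ} (hlam : 0 < lam) (hmu : 0 < mu) (hw : 0 < w)
    (hγ : 0 < γ) (hp : 0 < p) (hx0 : 0 ≤ x) (hx1 : x < 1 / γ)
    (hq : w * γ * (lam + mu * p) * x ^ 2
      - (w * (lam + mu * p + lam * γ) + lam * mu * p) * x + lam * w = 0) :
    0 < x ∧ 0 < 1 - x ∧ 0 < 1 - γ * x ∧
      lam * w * (1 - γ * x) * (1 - x) = mu * p * x * (w * (1 - γ * x) + lam) := by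
  have hu : 0 < 1 - γ * x := by
    rw [lt_div_iff₀ hγ] at hx1
    linarith
  have hb : lam * w * (1 - γ * x) * (1 - x) = mu * p * x * (w * (1 - γ * x) + lam) := by
    linear_combination hq
  have hx : 0 < x := by
    refine hx0.lt_of_ne ?_
    rintro rfl
    have : 0 < lam * w := by positivity
    linarith
  have hpos : 0 < lam * w * (1 - γ * x) * (1 - x) := hb ▸ by positivity
  exact ⟨hx, pos_of_mul_pos_right hpos (by positivity), hu, hb⟩

theorem stmt12 (lam mu w γ : ℝ) (hlam : 0 < lam) (hmu : 0 < mu) (hw : 0 < w)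
    (hγ : 0 < γ)
    (p₁ p₂ x₁ x₂ : ℝ) (hp₁ : 0 < p₁) (hp : p₁ < p₂) (hp₂ : p₂ ≤ 1)
    (hx₁0 : 0 ≤ x₁) (hx₁1 : x₁ < 1/γ)
    (hq₁ : w * γ * (lam + mu * p₁) * x₁^2
        - (w * (lam + mu * p₁ + lam * γ) + lam * mu * p₁) * x₁ + lam * w = 0)
    (hx₂0 : 0 ≤ x₂) (hx₂1 : x₂ < 1/γ)
    (hq₂ : w * γ * (lam + mu * p₂) * x₂^2
        - (w * (lam + mu * p₂ + lam * γ) + lam * mu * p₂) * x₂ + lam * w = 0) :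
    x₂ < x₁ := by
  obtain ⟨hx₁, hy₁, hu₁, hb₁⟩ := equilibrium_balance hlam hmu hw hγ hp₁ hx₁0 hx₁1 hq₁
  obtain ⟨hx₂, hy₂, hu₂, hb₂⟩ :=
    equilibrium_balance hlam hmu hw hγ (hp₁.trans hp) hx₂0 hx₂1 hq₂
  by_contra! hle
  have hu : (1 - γ * x₂) * (w * (1 - γ * x₁) + lam) ≤
      (1 - γ * x₁) * (w * (1 - γ * x₂) + lam) := by
    have := mul_le_mul_of_nonneg_left hle (mul_pos hlam hγ).le
    linarith
  have hy : (1 - x₂) * x₁ ≤ (1 - x₁) * x₂ := by linarith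
  have hlt : (1 - γ * x₂) * (w * (1 - γ * x₁) + lam) * ((1 - x₂) * x₁) * p₁ <
      (1 - γ * x₁) * (w * (1 - γ * x₂) + lam) * ((1 - x₁) * x₂) * p₂ :=
    mul_lt_mul' (mul_le_mul hu hy (by positivity) (by positivity)) hp hp₁.le (by positivity)
  -- Cross-multiplying the two balance equations makes both sides of `hlt` equal.
  have heq : lam * w * mu * ((1 - γ * x₂) * (w * (1 - γ * x₁) + lam) * ((1 - x₂) * x₁) * p₁) =
      lam * w * mu * ((1 - γ * x₁) * (w * (1 - γ * x₂) + lam) * ((1 - x₁) * x₂) * p₂) := by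
    linear_combination (mu * p₁ * x₁ * (w * (1 - γ * x₁) + lam)) * hb₂ -
      (mu * p₂ * x₂ * (w * (1 - γ * x₂) + lam)) * hb₁
  exact hlt.ne (mul_left_cancel₀ (by positivity) heq)
end

section
/- Fix real numbers λ > 0, μ > 0, w > 0 and γ > 0. Let 0 < p₁ < p₂ ≤ 1, and let x₁, x₂ ∈ [0, 1/γ) satisfy the policy-(W) equilibrium quadratic equation wγ(λ+μpᵢ)·xᵢ² − (w(λ + μpᵢ + λγ) + λμ)·xᵢ + λw = 0 for i = 1, 2. Then: (i) x₁ > x₂ (the equilibrium service fraction x_S* is strictly decreasing in p); (ii) μx₁/(w(1−γx₁)) > μx₂/(w(1−γx₂)) (the equilibrium waiting fraction x_W* = μx_S*/(w(1−γx_S*)) is strictly decreasing in p); and (iii) (μp₁/λ)x₁ < (μp₂/λ)x₂ (the equilibrium idle fraction x_I* = (μp/λ)x_S* is strictly increasing in p). -/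
/-- Dividing the equilibrium quadratic by `lam * w * (1 - γ * x)` shows that the idle, service and
waiting fractions sum to one. -/
theorem idle_add_service_add_waiting_eq_one {lam mu w γ p x : ℝ} (hlam : 0 < lam) (hw : 0 < w)
    (hx : 0 < 1 - γ * x)
    (hq : w * γ * (lam + mu * p) * x^2
        - (w * (lam + mu * p + lam * γ) + lam * mu) * x + lam * w = 0) :
    mu * p / lam * x + x + mu * x / (w * (1 - γ * x)) = 1 := by
  obtain ⟨d, hd⟩ : ∃ d, d = 1 - γ * x := ⟨_, rfl⟩
  rw [← hd] at hx ⊢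
  field_simp
  subst hd
  linear_combination -hq

theorem waiting_strictMonoOn {mu w γ : ℝ} (hmu : 0 < mu) (hw : 0 < w) :
    StrictMonoOn (fun x : ℝ => mu * x / (w * (1 - γ * x))) {x | 0 < 1 - γ * x} := by
  intro x hx y hy hxy
  have hx : 0 < 1 - γ * x := hx
  have hy : 0 < 1 - γ * y := hy
  change mu * x / (w * (1 - γ * x)) < mu * y / (w * (1 - γ * y))
  rw [div_lt_div_iff₀ (mul_pos hw hx) (mul_pos hw hy)]
  linear_combination mu * w * hxy

theorem stmt14 (lam mu w γ : ℝ) (hlam : 0 < lam) (hmu : 0 < mu) (hw : 0 < w)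
    (hγ : 0 < γ)
    (p₁ p₂ x₁ x₂ : ℝ) (hp₁ : 0 < p₁) (hp : p₁ < p₂) (hp₂ : p₂ ≤ 1)
    (hx₁0 : 0 ≤ x₁) (hx₁1 : x₁ < 1/γ)
    (hq₁ : w * γ * (lam + mu * p₁) * x₁^2
        - (w * (lam + mu * p₁ + lam * γ) + lam * mu) * x₁ + lam * w = 0)
    (hx₂0 : 0 ≤ x₂) (hx₂1 : x₂ < 1/γ)
    (hq₂ : w * γ * (lam + mu * p₂) * x₂^2
        - (w * (lam + mu * p₂ + lam * γ) + lam * mu) * x₂ + lam * w = 0) :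
    x₂ < x₁ ∧
    mu * x₂ / (w * (1 - γ * x₂)) < mu * x₁ / (w * (1 - γ * x₁)) ∧
    (mu * p₁ / lam) * x₁ < (mu * p₂ / lam) * x₂ := by
  have pos {x : ℝ} (hx : x < 1 / γ) : 0 < 1 - γ * x := by
    rw [lt_div_iff₀ hγ] at hx
    linarith
  have hW := waiting_strictMonoOn (γ := γ) hmu hw
  have hsum₁ := idle_add_service_add_waiting_eq_one hlam hw (pos hx₁1) hq₁
  have hsum₂ := idle_add_service_add_waiting_eq_one hlam hw (pos hx₂1) hq₂
  have hx : x₂ < x₁ := by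
    by_contra! hle
    have hWle : mu * x₁ / (w * (1 - γ * x₁)) ≤ mu * x₂ / (w * (1 - γ * x₂)) :=
      hW.monotoneOn (pos hx₁1) (pos hx₂1) hle
    have hx₂ : 0 < x₂ := by
      refine hx₂0.lt_of_ne ?_
      rintro rfl
      simp at hsum₂
    have hI : mu * p₁ / lam * x₁ < mu * p₂ / lam * x₂ :=
      calc mu * p₁ / lam * x₁ ≤ mu * p₁ / lam * x₂ := by gcongr
        _ < mu * p₂ / lam * x₂ := by gcongr
    linarith
  have hWlt : mu * x₂ / (w * (1 - γ * x₂)) < mu * x₁ / (w * (1 - γ * x₁)) :=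
    hW (pos hx₂1) (pos hx₁1) hx
  exact ⟨hx, hWlt, by linarith⟩
end

section
/- Fix real numbers λ > 0, μ > 0 and γ > 0. Let 0 < w₁ < w₂, and let x₁, x₂ ∈ [0, 1/γ) satisfy the policy-(I) equilibrium quadratic equation wᵢγ(λ+μ)·xᵢ² − (wᵢ(λ + μ + λγ) + λμ)·xᵢ + λwᵢ = 0 for i = 1, 2. Then w₁(1 − γx₁) < w₂(1 − γx₂); that is, the effective waiting rate k = w(1 − γ x_S*) under policy (I) is strictly increasing in the waiting rate w. -/
/-- The service fraction `x`, tied to the effective waiting rate `k` by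
`k * (lam - (lam + mu) * x) = lam * mu * x`, is monotone in `k`. -/
theorem service_fraction_le_of_rate_le {lam mu k₁ k₂ x₁ x₂ : ℝ} (hlam : 0 < lam) (hmu : 0 < mu)
    (hk₂ : 0 < k₂) (hk : k₂ ≤ k₁) (hx₂ : 0 ≤ x₂)
    (h₁ : k₁ * (lam - (lam + mu) * x₁) = lam * mu * x₁)
    (h₂ : k₂ * (lam - (lam + mu) * x₂) = lam * mu * x₂) : x₂ ≤ x₁ := by
  by_contra! hlt
  have hA : 0 ≤ lam - (lam + mu) * x₂ :=
    nonneg_of_mul_nonneg_right (h₂ ▸ by positivity) hk₂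
  have hA' : lam - (lam + mu) * x₂ ≤ lam - (lam + mu) * x₁ := by gcongr
  have hle : k₂ * (lam - (lam + mu) * x₂) ≤ k₁ * (lam - (lam + mu) * x₁) :=
    mul_le_mul hk hA' hA (hk₂.le.trans hk)
  rw [h₁, h₂] at hle
  exact hlt.not_ge (le_of_mul_le_mul_left hle (mul_pos hlam hmu))

theorem stmt15 (lam mu γ : ℝ) (hlam : 0 < lam) (hmu : 0 < mu) (hγ : 0 < γ)
    (w₁ w₂ x₁ x₂ : ℝ) (hw₁ : 0 < w₁) (hw : w₁ < w₂)
    (hx₁0 : 0 ≤ x₁) (hx₁1 : x₁ < 1/γ)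
    (hq₁ : w₁ * γ * (lam + mu) * x₁^2
        - (w₁ * (lam + mu + lam * γ) + lam * mu) * x₁ + lam * w₁ = 0)
    (hx₂0 : 0 ≤ x₂) (hx₂1 : x₂ < 1/γ)
    (hq₂ : w₂ * γ * (lam + mu) * x₂^2
        - (w₂ * (lam + mu + lam * γ) + lam * mu) * x₂ + lam * w₂ = 0) :
    w₁ * (1 - γ * x₁) < w₂ * (1 - γ * x₂) := by
  have pos {x : ℝ} (hx : x < 1 / γ) : 0 < 1 - γ * x := by
    rw [lt_div_iff₀ hγ] at hx
    linarith
  by_contra! hk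
  have hx : x₂ ≤ x₁ := service_fraction_le_of_rate_le hlam hmu
    (mul_pos (hw₁.trans hw) (pos hx₂1)) hk hx₂0
    (by linear_combination hq₁) (by linear_combination hq₂)
  have hle : 1 - γ * x₁ ≤ 1 - γ * x₂ := by gcongr
  exact hk.not_gt (mul_lt_mul hw hle (pos hx₁1) (hw₁.trans hw).le)
end

section
/- Fix real numbers λ > 0, μ > 0 and w > 0. Let 0 < γ₁ < γ₂, and let x₁, x₂ satisfy 0 ≤ xᵢ < 1/γᵢ and the policy-(I) equilibrium quadratic equation wγᵢ(λ+μ)·xᵢ² − (w(λ + μ + λγᵢ) + λμ)·xᵢ + λw = 0 for i = 1, 2. Then w(1 − γ₁x₁) > w(1 − γ₂x₂); that is, the effective waiting rate k = w(1 − γ x_S*) under policy (I) is strictly decreasing in the device-to-channel ratio γ. -/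
/-- The balance equation `lam * mu * x = w * t * (lam - (lam + mu) * x)` determines `x` as a
monotone function of `t > 0`. -/
theorem le_of_balance {lam mu w t₁ t₂ x₁ x₂ : ℝ} (hlam : 0 < lam) (hmu : 0 < mu) (hw : 0 < w)
    (ht₁ : 0 < t₁) (ht : t₁ ≤ t₂) (hx₁ : 0 ≤ x₁)
    (h₁ : lam * mu * x₁ = w * t₁ * (lam - (lam + mu) * x₁))
    (h₂ : lam * mu * x₂ = w * t₂ * (lam - (lam + mu) * x₂)) : x₁ ≤ x₂ := by
  by_contra! hlt
  have hfactor : 0 ≤ lam - (lam + mu) * x₁ :=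
    nonneg_of_mul_nonneg_right (h₁ ▸ by positivity) (mul_pos hw ht₁)
  have hle : w * t₁ * (lam - (lam + mu) * x₁) ≤ w * t₂ * (lam - (lam + mu) * x₂) := by
    have : 0 < t₂ := ht₁.trans_le ht
    gcongr
  rw [← h₁, ← h₂] at hle
  exact hlt.not_ge (le_of_mul_le_mul_left hle (mul_pos hlam hmu))

theorem stmt16 (lam mu w : ℝ) (hlam : 0 < lam) (hmu : 0 < mu) (hw : 0 < w)
    (γ₁ γ₂ x₁ x₂ : ℝ) (hγ₁ : 0 < γ₁) (hγ : γ₁ < γ₂)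
    (hx₁0 : 0 ≤ x₁) (hx₁1 : x₁ < 1/γ₁)
    (hq₁ : w * γ₁ * (lam + mu) * x₁^2
        - (w * (lam + mu + lam * γ₁) + lam * mu) * x₁ + lam * w = 0)
    (hx₂0 : 0 ≤ x₂) (hx₂1 : x₂ < 1/γ₂)
    (hq₂ : w * γ₂ * (lam + mu) * x₂^2
        - (w * (lam + mu + lam * γ₂) + lam * mu) * x₂ + lam * w = 0) :
    w * (1 - γ₂ * x₂) < w * (1 - γ₁ * x₁) := by
  have hγ₂ : 0 < γ₂ := hγ₁.trans hγ
  have ht₁ : 0 < 1 - γ₁ * x₁ := by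
    rw [lt_div_iff₀ hγ₁] at hx₁1
    linarith
  refine mul_lt_mul_of_pos_left ?_ hw
  by_contra! ht
  have hx : x₁ ≤ x₂ :=
    le_of_balance hlam hmu hw ht₁ ht hx₁0 (by linear_combination -hq₁)
      (by linear_combination -hq₂)
  have hx₁pos : 0 < x₁ := by
    refine hx₁0.lt_of_ne fun h => ?_
    subst h
    have := mul_pos hlam hw
    linarith
  have : γ₁ * x₁ < γ₂ * x₂ := mul_lt_mul hγ hx hx₁pos hγ₂.le
  linarith
end

section
/- Fix real numbers λ > 0, μ > 0 and p ∈ (0,1]. Then the functions k ↦ Δ_I-WP(λ,k,μ,p) and k ↦ Δ_I-WOP(λ,k,μ,p) are strictly decreasing on (0, ∞); that is, for any 0 < k₁ < k₂, Δ_I-WP(λ,k₁,μ,p) > Δ_I-WP(λ,k₂,μ,p) and Δ_I-WOP(λ,k₁,μ,p) > Δ_I-WOP(λ,k₂,μ,p). -/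
noncomputable def ΔIWP (lam k mu p : ℝ) : ℝ :=
  (1/lam + 1/k + 1/mu) * (1/p) + (lam + k + mu) / ((lam + mu) * (lam + k))
    - (lam + k + mu) / (lam * k + k * mu + lam * mu)

noncomputable def ΔIWOP (lam k mu p : ℝ) : ℝ :=
  (1/lam + 1/k + 1/mu) * (1/p) + 1/mu + 1/(lam + k)
    - (lam + k + mu) / (lam * k + k * mu + lam * mu)

/-- Increasing the waiting rate lowers `1/k` by more than it lowers the subtracted
correction term `(lam + k + mu) / (lam * k + k * mu + lam * mu)`. -/
theorem correction_sub_lt_inv_sub {lam mu k₁ k₂ : ℝ} (hlam : 0 < lam) (hmu : 0 < mu)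
    (hk₁ : 0 < k₁) (hk : k₁ < k₂) :
    (lam + k₁ + mu) / (lam * k₁ + k₁ * mu + lam * mu)
      - (lam + k₂ + mu) / (lam * k₂ + k₂ * mu + lam * mu) < 1 / k₁ - 1 / k₂ := by
  have hk₂ : 0 < k₂ := hk₁.trans hk
  have hd : 0 < k₂ - k₁ := sub_pos.2 hk
  have key : 1 / k₁ - 1 / k₂ - ((lam + k₁ + mu) / (lam * k₁ + k₁ * mu + lam * mu)
      - (lam + k₂ + mu) / (lam * k₂ + k₂ * mu + lam * mu)) =
      (k₂ - k₁) * (lam * mu * (k₁ * k₂ + (lam + mu) * (k₁ + k₂) + lam * mu)) /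
        (k₁ * k₂ * (lam * k₁ + k₁ * mu + lam * mu) * (lam * k₂ + k₂ * mu + lam * mu)) := by
    have h₁ : lam * k₁ + k₁ * mu + lam * mu ≠ 0 := by positivity
    have h₂ : lam * k₂ + k₂ * mu + lam * mu ≠ 0 := by positivity
    field_simp
    ring
  rw [← sub_pos, key]
  positivity

theorem stmt17 (lam mu p : ℝ) (hlam : 0 < lam) (hmu : 0 < mu)
    (hp0 : 0 < p) (hp1 : p ≤ 1) :
    ∀ k₁ k₂ : ℝ, 0 < k₁ → k₁ < k₂ →
      ΔIWP lam k₂ mu p < ΔIWP lam k₁ mu p ∧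
      ΔIWOP lam k₂ mu p < ΔIWOP lam k₁ mu p := by
  intro k₁ k₂ hk₁ hk
  have hk₂ : 0 < k₂ := hk₁.trans hk
  have hcorr := correction_sub_lt_inv_sub hlam hmu hk₁ hk
  have hinv : 1 / k₁ - 1 / k₂ ≤ (1 / k₁ - 1 / k₂) * (1 / p) :=
    le_mul_of_one_le_right (sub_nonneg.2 (one_div_le_one_div_of_le hk₁ hk.le))
      (one_le_one_div hp0 hp1)
  have hwait : 1 / (lam + k₂) ≤ 1 / (lam + k₁) :=
    one_div_le_one_div_of_le (by positivity) (by linarith)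
  have hserv : ∀ k, 0 < k → (lam + k + mu) / ((lam + mu) * (lam + k)) =
      1 / (lam + mu) + mu / (lam + mu) * (1 / (lam + k)) := by
    intro k hk
    field_simp
  have hserv_le := mul_le_mul_of_nonneg_left hwait
    (show 0 ≤ mu / (lam + mu) by positivity)
  constructor
  · unfold ΔIWP
    rw [hserv k₁ hk₁, hserv k₂ hk₂]
    linarith
  · unfold ΔIWOP
    linarith
end

section
/- Fix real numbers λ > 0, μ > 0 and p ∈ (0,1]. Then the functions k ↦ Δ_S-WP(λ,k,μ,p) and k ↦ Δ_S-WOP(λ,k,μ,p) are strictly decreasing on (0, ∞); that is, for any 0 < k₁ < k₂, Δ_S-WP(λ,k₁,μ,p) > Δ_S-WP(λ,k₂,μ,p) and Δ_S-WOP(λ,k₁,μ,p) > Δ_S-WOP(λ,k₂,μ,p). -/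
noncomputable def ΔSWP (lam k mu p : ℝ) : ℝ :=
  1/lam + 1/k + 1/(mu * p) + (mu * p + k + lam) / ((lam + mu * p) * (lam + k))
    - (lam + k + mu * p) / (lam * k + (k + lam) * mu * p)

noncomputable def ΔSWOP (lam k mu p : ℝ) : ℝ :=
  1/lam + 1/k + 2/(mu * p) + 1/(lam + k)
    - (lam + k + mu * p) / (lam * k + (k + lam) * mu * p)

/-- The part of both ages that depends on `k` through the waiting stage is strictly decreasing. -/
lemma inv_sub_div_strictAnti {l m a b : ℝ} (hl : 0 < l) (hm : 0 < m) (ha : 0 < a) (hab : a < b) :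
    1 / b - (l + b + m) / (l * b + (b + l) * m) < 1 / a - (l + a + m) / (l * a + (a + l) * m) := by
  have hb : 0 < b := ha.trans hab
  have key : (1 / a - (l + a + m) / (l * a + (a + l) * m))
      - (1 / b - (l + b + m) / (l * b + (b + l) * m))
      = (b - a) * ((l + m) * l * m * (a + b) + l ^ 2 * m ^ 2 + l * m * a * b)
        / (a * b * (l * a + (a + l) * m) * (l * b + (b + l) * m)) := by
    have h₁ : l * a + (a + l) * m ≠ 0 := by positivity
    have h₂ : l * b + (b + l) * m ≠ 0 := by positivity
    field_simp
    ring
  have hba : 0 < b - a := sub_pos.mpr hab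
  rw [← sub_pos, key]
  positivity

/-- The service term under preemption is strictly decreasing in `k`. -/
lemma service_term_strictAnti {l m a b : ℝ} (hl : 0 < l) (hm : 0 < m) (ha : 0 < a) (hab : a < b) :
    (m + b + l) / ((l + m) * (l + b)) < (m + a + l) / ((l + m) * (l + a)) := by
  have hb : 0 < b := ha.trans hab
  rw [div_lt_div_iff₀ (by positivity) (by positivity), ← sub_pos]
  have hba : 0 < b - a := sub_pos.mpr hab
  have key : (m + a + l) * ((l + m) * (l + b)) - (m + b + l) * ((l + m) * (l + a))
      = (l + m) * m * (b - a) := by ring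
  rw [key]
  positivity

theorem stmt18 (lam mu p : ℝ) (hlam : 0 < lam) (hmu : 0 < mu)
    (hp0 : 0 < p) (hp1 : p ≤ 1) :
    ∀ k₁ k₂ : ℝ, 0 < k₁ → k₁ < k₂ →
      ΔSWP lam k₂ mu p < ΔSWP lam k₁ mu p ∧
      ΔSWOP lam k₂ mu p < ΔSWOP lam k₁ mu p := by
  intro k₁ k₂ hk₁ hk
  have hm : 0 < mu * p := mul_pos hmu hp0
  have hwait := inv_sub_div_strictAnti hlam hm hk₁ hk
  have hserv := service_term_strictAnti hlam hm hk₁ hk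
  have hinv : 1 / (lam + k₂) < 1 / (lam + k₁) :=
    one_div_lt_one_div_of_lt (by positivity) (by linarith)
  simp only [ΔSWP, ΔSWOP, mul_assoc _ mu p]
  constructor <;> linarith
end

section
/- Fix real numbers λ > 0, μ > 0 and p ∈ (0,1]. For w > 0 and γ > 0, let x_S*(w,γ) ∈ [0, 1/γ) be the unique solution of the policy-(I) equilibrium quadratic equation wγ(λ+μ)·x² − (w(λ + μ + λγ) + λμ)·x + λw = 0, and let k(w,γ) = w(1 − γ·x_S*(w,γ)) be the effective waiting rate. Then the mean-field average AoI of policy (I) with preemption, w ↦ Δ_I-WP(λ, k(w,γ), μ, p), is strictly decreasing in w for each fixed γ > 0, and γ ↦ Δ_I-WP(λ, k(w,γ), μ, p) is strictly increasing in γ for each fixed w > 0. -/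
/-- The average age of information is strictly decreasing in the effective waiting rate. -/
theorem ΔIWP_strictAntiOn {lam mu p : ℝ} (hlam : 0 < lam) (hmu : 0 < mu)
    (hp0 : 0 < p) (hp1 : p ≤ 1) :
    StrictAntiOn (fun k => ΔIWP lam k mu p) (Set.Ioi 0) := by
  have decomposition : ∀ k : ℝ, 0 < k → ΔIWP lam k mu p =
      (1 / lam + 1 / mu) * (1 / p) + 1 / (lam + mu) + (1 / p - 1) * (1 / k)
        + mu / ((lam + mu) * (lam + k))
        + lam * mu / (k * ((lam + mu) * k + lam * mu))
        - k / ((lam + mu) * k + lam * mu) := by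
    intro k hk
    have hS : (lam + mu) * k + lam * mu ≠ 0 := by positivity
    have hS' : lam * k + k * mu + lam * mu = (lam + mu) * k + lam * mu := by ring
    have hlk : lam + k ≠ 0 := by positivity
    have hlm : lam + mu ≠ 0 := by positivity
    have service : (lam + k + mu) / ((lam + mu) * (lam + k))
        = 1 / (lam + mu) + mu / ((lam + mu) * (lam + k)) := by
      field_simp
    have waiting : 1 / k - (lam + k + mu) / ((lam + mu) * k + lam * mu)
        = lam * mu / (k * ((lam + mu) * k + lam * mu))
          - k / ((lam + mu) * k + lam * mu) := by
      field_simp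
      ring
    unfold ΔIWP
    rw [hS']
    linear_combination service + waiting
  intro a ha b hb hab
  simp only [Set.mem_Ioi] at ha hb
  simp only [decomposition a ha, decomposition b hb]
  have hp : 0 ≤ 1 / p - 1 := sub_nonneg.mpr ((one_le_div hp0).mpr hp1)
  have h₁ : (1 / p - 1) * (1 / b) ≤ (1 / p - 1) * (1 / a) := by gcongr
  have h₂ : mu / ((lam + mu) * (lam + b)) < mu / ((lam + mu) * (lam + a)) := by gcongr
  have h₃ : lam * mu / (b * ((lam + mu) * b + lam * mu))
      ≤ lam * mu / (a * ((lam + mu) * a + lam * mu)) := by gcongr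
  have h₄ : a / ((lam + mu) * a + lam * mu) ≤ b / ((lam + mu) * b + lam * mu) := by
    rw [div_le_div_iff₀ (by positivity) (by positivity)]
    nlinarith [mul_lt_mul_of_pos_left hab (mul_pos hlam hmu)]
  linarith

/-- At equilibrium, the fraction of devices in service is a function of the effective
waiting rate. -/
theorem equilibrium_eq_div {lam mu w γ x : ℝ} (hlam : 0 < lam) (hmu : 0 < mu)
    (hk : 0 < w * (1 - γ * x))
    (h : w * γ * (lam + mu) * x ^ 2
      - (w * (lam + mu + lam * γ) + lam * mu) * x + lam * w = 0) :
    x = lam * (w * (1 - γ * x)) / ((lam + mu) * (w * (1 - γ * x)) + lam * mu) := by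
  rw [eq_div_iff (by positivity)]
  linear_combination -h

/-- The equilibrium service fraction is monotone in the effective waiting rate. -/
theorem equilibrium_le_of_rate_le {lam mu w₁ w₂ γ₁ γ₂ x₁ x₂ : ℝ}
    (hlam : 0 < lam) (hmu : 0 < mu)
    (hk₁ : 0 < w₁ * (1 - γ₁ * x₁)) (hk₂ : 0 < w₂ * (1 - γ₂ * x₂))
    (h₁ : w₁ * γ₁ * (lam + mu) * x₁ ^ 2
      - (w₁ * (lam + mu + lam * γ₁) + lam * mu) * x₁ + lam * w₁ = 0)
    (h₂ : w₂ * γ₂ * (lam + mu) * x₂ ^ 2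
      - (w₂ * (lam + mu + lam * γ₂) + lam * mu) * x₂ + lam * w₂ = 0)
    (hle : w₁ * (1 - γ₁ * x₁) ≤ w₂ * (1 - γ₂ * x₂)) : x₁ ≤ x₂ := by
  rw [equilibrium_eq_div hlam hmu hk₁ h₁, equilibrium_eq_div hlam hmu hk₂ h₂]
  generalize w₁ * (1 - γ₁ * x₁) = a at *
  generalize w₂ * (1 - γ₂ * x₂) = b at *
  rw [div_le_div_iff₀ (by positivity) (by positivity)]
  nlinarith [mul_le_mul_of_nonneg_left hle (by positivity : 0 ≤ lam * (lam * mu))]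

theorem stmt19 (lam mu p : ℝ) (hlam : 0 < lam) (hmu : 0 < mu)
    (hp0 : 0 < p) (hp1 : p ≤ 1) :
    (∀ γ w₁ w₂ x₁ x₂ : ℝ, 0 < γ → 0 < w₁ → w₁ < w₂ →
      0 ≤ x₁ → x₁ < 1/γ →
      w₁ * γ * (lam + mu) * x₁^2
        - (w₁ * (lam + mu + lam * γ) + lam * mu) * x₁ + lam * w₁ = 0 →
      0 ≤ x₂ → x₂ < 1/γ →
      w₂ * γ * (lam + mu) * x₂^2
        - (w₂ * (lam + mu + lam * γ) + lam * mu) * x₂ + lam * w₂ = 0 →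
      ΔIWP lam (w₂ * (1 - γ * x₂)) mu p < ΔIWP lam (w₁ * (1 - γ * x₁)) mu p) ∧
    (∀ w γ₁ γ₂ x₁ x₂ : ℝ, 0 < w → 0 < γ₁ → γ₁ < γ₂ →
      0 ≤ x₁ → x₁ < 1/γ₁ →
      w * γ₁ * (lam + mu) * x₁^2
        - (w * (lam + mu + lam * γ₁) + lam * mu) * x₁ + lam * w = 0 →
      0 ≤ x₂ → x₂ < 1/γ₂ →
      w * γ₂ * (lam + mu) * x₂^2
        - (w * (lam + mu + lam * γ₂) + lam * mu) * x₂ + lam * w = 0 →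
      ΔIWP lam (w * (1 - γ₁ * x₁)) mu p < ΔIWP lam (w * (1 - γ₂ * x₂)) mu p) := by
  have rate_pos : ∀ w γ x : ℝ, 0 < w → 0 < γ → x < 1 / γ → 0 < w * (1 - γ * x) := by
    intro w γ x hw hγ hx
    rw [lt_div_iff₀ hγ] at hx
    exact mul_pos hw (by linarith)
  refine ⟨?_, ?_⟩
  · intro γ w₁ w₂ x₁ x₂ hγ hw₁ hw _ hx₁ h₁ _ hx₂ h₂
    have hw₂ := hw₁.trans hw
    have hk₁ := rate_pos w₁ γ x₁ hw₁ hγ hx₁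
    have hk₂ := rate_pos w₂ γ x₂ hw₂ hγ hx₂
    refine ΔIWP_strictAntiOn hlam hmu hp0 hp1 hk₁ hk₂ ?_
    by_contra! hle
    have hx := equilibrium_le_of_rate_le hlam hmu hk₂ hk₁ h₂ h₁ hle
    have hfree : 1 - γ * x₁ ≤ 1 - γ * x₂ := by gcongr
    have hfree_pos : 0 < 1 - γ * x₁ := pos_of_mul_pos_right hk₁ hw₁.le
    have : w₁ * (1 - γ * x₁) < w₂ * (1 - γ * x₂) :=
      mul_lt_mul hw hfree hfree_pos hw₂.le
    linarith
  · intro w γ₁ γ₂ x₁ x₂ hw hγ₁ hγ _ hx₁ h₁ _ hx₂ h₂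
    have hγ₂ := hγ₁.trans hγ
    have hk₁ := rate_pos w γ₁ x₁ hw hγ₁ hx₁
    have hk₂ := rate_pos w γ₂ x₂ hw hγ₂ hx₂
    refine ΔIWP_strictAntiOn hlam hmu hp0 hp1 hk₂ hk₁ ?_
    by_contra! hle
    have hx := equilibrium_le_of_rate_le hlam hmu hk₁ hk₂ h₁ h₂ hle
    have hx₂_pos : 0 < x₂ := by
      rw [equilibrium_eq_div hlam hmu hk₂ h₂]
      positivity
    have hload : γ₁ * x₁ < γ₂ * x₂ :=
      (mul_le_mul_of_nonneg_left hx hγ₁.le).trans_lt (mul_lt_mul_of_pos_right hγ hx₂_pos)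
    have : w * (1 - γ₂ * x₂) < w * (1 - γ₁ * x₁) := by gcongr
    linarith
end
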